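/- arXiv:0707.1521 — 2 statements merged into one kernel-verified Lean document; each statement's English description precedes it below -/
import Mathlib

section
/- Let Ψ and Φ be unit vectors in H = ℂ^{d_A} ⊗ ℂ^{d_B}, let α, β ∈ ℂ with |α|² + |β|² = 1, and set Γ₊ = αΨ + βΦ, Γ₋ = αΨ − βΦ, n₊ = ‖Γ₊‖², n₋ = ‖Γ₋‖², ρ^A = |α|² Tr_B|Ψ⟩⟨Ψ| + |β|² Tr_B|Φ⟩⟨Φ|, and ρ^B = |α|² Tr_A|Ψ⟩⟨Ψ| + |β|² Tr_A|Φ⟩⟨Φ|. Then (n₊/2)·E(Γ₊) + (n₋/2)·E(Γ₋) ≤ min{S(ρ^A), S(ρ^B)}, where any term with n_± = 0 is read as 0. -/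
open scoped BigOperators

noncomputable section

namespace EoS

/-- Vectors of `ℂ^{dA} ⊗ ℂ^{dB}`, modeled as `EuclideanSpace ℂ (Fin dA × Fin dB)`. -/
abbrev TensorSpace (dA dB : ℕ) := EuclideanSpace ℂ (Fin dA × Fin dB)

variable {dA dB : ℕ}

/-- The rank-one operator `|ψ⟩⟨ψ| = ψ ψ†`, as a matrix. -/
def ketbra (ψ : TensorSpace dA dB) : Matrix (Fin dA × Fin dB) (Fin dA × Fin dB) ℂ :=
  fun p q => ψ p * (starRingEnd ℂ) (ψ q)

/-- Partial trace over the `B` system. -/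
def trB (ρ : Matrix (Fin dA × Fin dB) (Fin dA × Fin dB) ℂ) : Matrix (Fin dA) (Fin dA) ℂ :=
  fun a a' => ∑ b : Fin dB, ρ (a, b) (a', b)

/-- Partial trace over the `A` system. -/
def trA (ρ : Matrix (Fin dA × Fin dB) (Fin dA × Fin dB) ℂ) : Matrix (Fin dB) (Fin dB) ℂ :=
  fun b b' => ∑ a : Fin dA, ρ (a, b) (a, b')

open scoped Classical in
/-- Von Neumann entropy (base-2), via eigenvalues; junk value `0` on non-Hermitian input. -/
def vnEntropy {n : Type*} [Fintype n] [DecidableEq n] (ρ : Matrix n n ℂ) : ℝ :=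
  if h : ρ.IsHermitian then -∑ i, (h.eigenvalues i) * Real.logb 2 (h.eigenvalues i) else 0

/-- Entropy of entanglement of a (unit) vector. -/
def ent (ψ : TensorSpace dA dB) : ℝ := vnEntropy (trB (ketbra ψ))

/-- Entropy of entanglement of a nonzero, not necessarily normalized, vector. -/
def entN (ψ : TensorSpace dA dB) : ℝ := ent ((‖ψ‖ : ℝ)⁻¹ • ψ)

/-- Binary entropy (base 2). -/
def h2 (x : ℝ) : ℝ := -x * Real.logb 2 x - (1 - x) * Real.logb 2 (1 - x)

/-- Elementary tensor `u ⊗ w`. -/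
def tensor (u : EuclideanSpace ℂ (Fin dA)) (w : EuclideanSpace ℂ (Fin dB)) :
    TensorSpace dA dB := WithLp.toLp 2 (fun p => u p.1 * w p.2)

/-- One-sided orthogonality on the `B` side:
`Tr[Tr_A(|Ψ⟩⟨Ψ|) ⬝ Tr_A(|Φ⟩⟨Φ|)] = 0`. -/
def OneSidedOrthB (Ψ Φ : TensorSpace dA dB) : Prop :=
  Matrix.trace (trA (ketbra Ψ) * trA (ketbra Φ)) = 0


section helpers

open scoped ComplexOrder

/-- entropy function in terms of negMulLog -/
def eta (x : ℝ) : ℝ := Real.negMulLog x / Real.log 2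

lemma eta_concave : ConcaveOn ℝ (Set.Ici (0 : ℝ)) eta := by
  have h := Real.concaveOn_negMulLog.smul
    (c := (Real.log 2)⁻¹) (inv_nonneg.mpr (Real.log_nonneg (by norm_num)))
  have e : eta = fun x => (Real.log 2)⁻¹ • Real.negMulLog x := by
    funext x; simp only [eta, smul_eq_mul]; ring
  rw [e]; exact h

lemma eta_zero : eta 0 = 0 := by simp [eta]

lemma vnEntropy_eq {n : Type*} [Fintype n] [DecidableEq n] {ρ : Matrix n n ℂ}
    (h : ρ.IsHermitian) : vnEntropy ρ = ∑ i, eta (h.eigenvalues i) := by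
  unfold vnEntropy
  rw [dif_pos h, ← Finset.sum_neg_distrib]
  refine Finset.sum_congr rfl fun i _ => ?_
  simp only [eta, Real.negMulLog, Real.logb]; ring

lemma vnEntropy_eq_roots {n : Type*} [Fintype n] [DecidableEq n] {ρ : Matrix n n ℂ}
    (h : ρ.IsHermitian) :
    vnEntropy ρ = (ρ.charpoly.roots.map (fun z : ℂ => eta z.re)).sum := by
  rw [vnEntropy_eq h, h.roots_charpoly_eq_eigenvalues, Multiset.map_map]
  simp

lemma roots_X_pow_mul {p : Polynomial ℂ} (hp : p ≠ 0) (k : ℕ) :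
    ((Polynomial.X ^ k * p).roots.map (fun z : ℂ => eta z.re)).sum
      = (p.roots.map (fun z : ℂ => eta z.re)).sum := by
  rw [Polynomial.roots_mul (mul_ne_zero (pow_ne_zero _ Polynomial.X_ne_zero) hp)]
  simp [eta_zero, Multiset.map_nsmul, Multiset.sum_nsmul]

/-- `M Mᴴ` and `(Mᴴ M)ᵀ` have the same entropy. -/
lemma vnEntropy_comm {m n : Type*} [Fintype m] [DecidableEq m] [Fintype n] [DecidableEq n]
    (M : Matrix m n ℂ) :
    vnEntropy (M * M.conjTranspose) = vnEntropy (M.transpose * M.transpose.conjTranspose) := by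
  have e : M.transpose * M.transpose.conjTranspose = (M.conjTranspose * M).transpose := by
    rw [Matrix.transpose_mul]; rfl
  rw [vnEntropy_eq_roots (Matrix.isHermitian_mul_conjTranspose_self M),
    vnEntropy_eq_roots (Matrix.isHermitian_mul_conjTranspose_self M.transpose), e,
    Matrix.charpoly_transpose,
    ← roots_X_pow_mul (Matrix.charpoly_monic (M * M.conjTranspose)).ne_zero (Fintype.card n),
    ← roots_X_pow_mul (Matrix.charpoly_monic (M.conjTranspose * M)).ne_zero (Fintype.card m),
    Matrix.charpoly_mul_comm']

/-- The diagonal of `σ` in any orthonormal basis has at least the entropy of `σ`. -/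
lemma vnEntropy_le_diag {n : Type*} [Fintype n] [DecidableEq n] {σ : Matrix n n ℂ}
    (h : σ.PosSemidef) (U : Matrix.unitaryGroup n ℂ) :
    vnEntropy σ ≤ ∑ i, eta (((star U : Matrix n n ℂ) * σ * (U : Matrix n n ℂ)) i i).re := by
  have hh := h.isHermitian
  set V := hh.eigenvectorUnitary with hV
  set W : Matrix.unitaryGroup n ℂ := star U * V with hW
  have hdiag : ∀ i, (((star U : Matrix n n ℂ) * σ * (U : Matrix n n ℂ)) i i).re
      = ∑ j, ‖(W : Matrix n n ℂ) i j‖ ^ 2 • hh.eigenvalues j := by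
    intro i
    have e : (star U : Matrix n n ℂ) * σ * (U : Matrix n n ℂ)
        = (W : Matrix n n ℂ) * Matrix.diagonal (RCLike.ofReal ∘ hh.eigenvalues)
          * star (W : Matrix n n ℂ) := by
      conv_lhs => rw [hh.spectral_theorem, Unitary.conjStarAlgAut_apply]
      simp [hW, hV, mul_assoc]
    rw [e, Matrix.mul_apply, Complex.re_sum]
    refine Finset.sum_congr rfl fun j _ => ?_
    rw [Matrix.mul_diagonal, Matrix.star_apply, mul_right_comm]
    have : (W : Matrix n n ℂ) i j * star ((W : Matrix n n ℂ) i j)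
        = ((‖(W : Matrix n n ℂ) i j‖ ^ 2 : ℝ) : ℂ) := by
      simpa using Complex.mul_conj' ((W : Matrix n n ℂ) i j)
    rw [this]
    simp [← Complex.ofReal_pow, ← Complex.ofReal_mul]
  have key : ∀ V : Matrix.unitaryGroup n ℂ, ∀ i, ∑ j, ‖(V : Matrix n n ℂ) i j‖ ^ 2 = 1 := by
    intro V i
    have h1 : ((V : Matrix n n ℂ) * star (V : Matrix n n ℂ)) i i = 1 := by
      rw [Matrix.mem_unitaryGroup_iff.mp V.2]; simp
    rw [Matrix.mul_apply] at h1
    have h2 : ((∑ j, ‖(V : Matrix n n ℂ) i j‖ ^ 2 : ℝ) : ℂ) = 1 := by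
      rw [← h1, Complex.ofReal_sum]
      refine Finset.sum_congr rfl fun j _ => ?_
      rw [Matrix.star_apply]
      simpa using (Complex.mul_conj' ((V : Matrix n n ℂ) i j)).symm
    exact_mod_cast h2
  have hrow := key W
  have hcol : ∀ j, ∑ i, ‖(W : Matrix n n ℂ) i j‖ ^ 2 = 1 := by
    intro j
    have := key (star W) j
    simpa [Matrix.star_apply] using this
  rw [vnEntropy_eq hh]
  calc ∑ j, eta (hh.eigenvalues j)
      = ∑ j, ∑ i, ‖(W : Matrix n n ℂ) i j‖ ^ 2 • eta (hh.eigenvalues j) := by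
        refine Finset.sum_congr rfl fun j _ => ?_
        rw [← Finset.sum_smul, hcol j, one_smul]
    _ = ∑ i, ∑ j, ‖(W : Matrix n n ℂ) i j‖ ^ 2 • eta (hh.eigenvalues j) := Finset.sum_comm
    _ ≤ _ := by
        refine Finset.sum_le_sum fun i _ => ?_
        rw [hdiag i]
        exact eta_concave.le_map_sum (fun _ _ => by positivity) (hrow i)
          (fun j _ => h.eigenvalues_nonneg j)

lemma diag_nonneg {n : Type*} [Fintype n] [DecidableEq n] {σ : Matrix n n ℂ}
    (h : σ.PosSemidef) (U : Matrix.unitaryGroup n ℂ) (i : n) :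
    0 ≤ (((star U : Matrix n n ℂ) * σ * (U : Matrix n n ℂ)) i i).re := by
  have := (h.conjTranspose_mul_mul_same (U : Matrix n n ℂ)).diag_nonneg (i := i)
  exact (Complex.le_def.mp this).1

/-- Concavity of the von Neumann entropy. -/
lemma vnEntropy_concave {n : Type*} [Fintype n] [DecidableEq n] {σ τ : Matrix n n ℂ}
    (hσ : σ.PosSemidef) (hτ : τ.PosSemidef) {p q : ℝ} (hp : 0 ≤ p) (hq : 0 ≤ q)
    (hpq : p + q = 1) :
    p * vnEntropy σ + q * vnEntropy τ ≤ vnEntropy (p • σ + q • τ) := by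
  have hρ : (p • σ + q • τ).IsHermitian := by
    have h1 := hσ.isHermitian
    have h2 := hτ.isHermitian
    unfold Matrix.IsHermitian at *
    rw [Matrix.conjTranspose_add, Matrix.conjTranspose_smul, Matrix.conjTranspose_smul, h1, h2]
    simp
  set U := hρ.eigenvectorUnitary with hU
  have heig : ∀ i, hρ.eigenvalues i
      = p • (((star U : Matrix n n ℂ) * σ * (U : Matrix n n ℂ)) i i).re
        + q • (((star U : Matrix n n ℂ) * τ * (U : Matrix n n ℂ)) i i).re := by
    intro i
    have h1 := hρ.conjStarAlgAut_star_eigenvectorUnitary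
    rw [Unitary.conjStarAlgAut_apply] at h1
    have h2 := congrArg (fun M : Matrix n n ℂ => (M i i).re) h1
    simp only [Matrix.diagonal_apply_eq, Function.comp] at h2
    rw [← hU] at h2
    have h3 : hρ.eigenvalues i
      = (((star U : Matrix n n ℂ) * (p • σ + q • τ) * (U : Matrix n n ℂ)) i i).re := by
      simpa using h2.symm
    rw [h3]
    simp [mul_add, add_mul]
  rw [vnEntropy_eq hρ]
  calc p * vnEntropy σ + q * vnEntropy τ
      ≤ p * ∑ i, eta (((star U : Matrix n n ℂ) * σ * (U : Matrix n n ℂ)) i i).re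
        + q * ∑ i, eta (((star U : Matrix n n ℂ) * τ * (U : Matrix n n ℂ)) i i).re :=
        add_le_add (mul_le_mul_of_nonneg_left (vnEntropy_le_diag hσ U) hp)
          (mul_le_mul_of_nonneg_left (vnEntropy_le_diag hτ U) hq)
    _ = ∑ i, (p • eta (((star U : Matrix n n ℂ) * σ * (U : Matrix n n ℂ)) i i).re
        + q • eta (((star U : Matrix n n ℂ) * τ * (U : Matrix n n ℂ)) i i).re) := by
        rw [Finset.sum_add_distrib, Finset.mul_sum, Finset.mul_sum]; rfl
    _ ≤ _ := by
        refine Finset.sum_le_sum fun i _ => ?_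
        rw [heig i]
        exact eta_concave.2 (diag_nonneg hσ U i) (diag_nonneg hτ U i) hp hq hpq

/-- Coefficient matrix of a vector. -/
def coeffM (ψ : TensorSpace dA dB) : Matrix (Fin dA) (Fin dB) ℂ := fun a b => ψ (a, b)

lemma trB_ketbra (ψ : TensorSpace dA dB) :
    trB (ketbra ψ) = coeffM ψ * (coeffM ψ).conjTranspose := by
  ext a a'
  simp [trB, ketbra, coeffM, Matrix.mul_apply]

lemma trA_ketbra (ψ : TensorSpace dA dB) :
    trA (ketbra ψ) = (coeffM ψ).transpose * (coeffM ψ).transpose.conjTranspose := by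
  ext a a'
  simp [trA, ketbra, coeffM, Matrix.mul_apply]

lemma ent_eq_trA (ψ : TensorSpace dA dB) : ent ψ = vnEntropy (trA (ketbra ψ)) := by
  rw [ent, trB_ketbra, trA_ketbra, vnEntropy_comm]

lemma trB_psd (ψ : TensorSpace dA dB) : (trB (ketbra ψ)).PosSemidef := by
  rw [trB_ketbra]; exact Matrix.posSemidef_self_mul_conjTranspose _

lemma trA_psd (ψ : TensorSpace dA dB) : (trA (ketbra ψ)).PosSemidef := by
  rw [trA_ketbra]; exact Matrix.posSemidef_self_mul_conjTranspose _

lemma ketbra_normalize (ψ : TensorSpace dA dB) (p q : Fin dA × Fin dB) :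
    ((‖ψ‖ ^ 2 / 2 : ℝ) : ℂ) * ketbra ((‖ψ‖ : ℝ)⁻¹ • ψ) p q = ketbra ψ p q / 2 := by
  by_cases h : ψ = 0
  · subst h; simp [ketbra]
  · have h' : (‖ψ‖ : ℂ) ≠ 0 := by simpa using h
    simp only [ketbra, PiLp.smul_apply, Complex.real_smul, map_mul, Complex.conj_ofReal]
    push_cast
    field_simp

lemma ketbra_avg (Ψ Φ : TensorSpace dA dB) (α β : ℂ) (p q : Fin dA × Fin dB) :
    ((‖α‖ ^ 2 : ℝ) : ℂ) * ketbra Ψ p q + ((‖β‖ ^ 2 : ℝ) : ℂ) * ketbra Φ p q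
    = ((‖α • Ψ + β • Φ‖ ^ 2 / 2 : ℝ) : ℂ)
        * ketbra ((‖α • Ψ + β • Φ‖ : ℝ)⁻¹ • (α • Ψ + β • Φ)) p q
      + ((‖α • Ψ - β • Φ‖ ^ 2 / 2 : ℝ) : ℂ)
        * ketbra ((‖α • Ψ - β • Φ‖ : ℝ)⁻¹ • (α • Ψ - β • Φ)) p q := by
  rw [ketbra_normalize, ketbra_normalize]
  have ha : ((‖α‖ ^ 2 : ℝ) : ℂ) = α * (starRingEnd ℂ) α := by
    simpa using (Complex.mul_conj' α).symm
  have hb : ((‖β‖ ^ 2 : ℝ) : ℂ) = β * (starRingEnd ℂ) β := by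
    simpa using (Complex.mul_conj' β).symm
  rw [ha, hb]
  simp only [ketbra, PiLp.add_apply, PiLp.sub_apply, PiLp.smul_apply, smul_eq_mul, map_add,
    map_sub, map_mul]
  ring

lemma trB_avg (Ψ Φ : TensorSpace dA dB) (α β : ℂ) :
    (‖α‖ ^ 2 : ℝ) • trB (ketbra Ψ) + (‖β‖ ^ 2 : ℝ) • trB (ketbra Φ)
    = (‖α • Ψ + β • Φ‖ ^ 2 / 2 : ℝ)
        • trB (ketbra ((‖α • Ψ + β • Φ‖ : ℝ)⁻¹ • (α • Ψ + β • Φ)))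
      + (‖α • Ψ - β • Φ‖ ^ 2 / 2 : ℝ)
        • trB (ketbra ((‖α • Ψ - β • Φ‖ : ℝ)⁻¹ • (α • Ψ - β • Φ))) := by
  ext a a'
  simp only [Matrix.add_apply, Matrix.smul_apply, trB, Complex.real_smul, Finset.mul_sum,
    ← Finset.sum_add_distrib]
  exact Finset.sum_congr rfl fun b _ => ketbra_avg Ψ Φ α β _ _

lemma trA_avg (Ψ Φ : TensorSpace dA dB) (α β : ℂ) :
    (‖α‖ ^ 2 : ℝ) • trA (ketbra Ψ) + (‖β‖ ^ 2 : ℝ) • trA (ketbra Φ)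
    = (‖α • Ψ + β • Φ‖ ^ 2 / 2 : ℝ)
        • trA (ketbra ((‖α • Ψ + β • Φ‖ : ℝ)⁻¹ • (α • Ψ + β • Φ)))
      + (‖α • Ψ - β • Φ‖ ^ 2 / 2 : ℝ)
        • trA (ketbra ((‖α • Ψ - β • Φ‖ : ℝ)⁻¹ • (α • Ψ - β • Φ))) := by
  ext a a'
  simp only [Matrix.add_apply, Matrix.smul_apply, trA, Complex.real_smul, Finset.mul_sum,
    ← Finset.sum_add_distrib]
  exact Finset.sum_congr rfl fun b _ => ketbra_avg Ψ Φ α β _ _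

end helpers

/-- the concavity lower bound
`(n₊/2)E(Γ₊) + (n₋/2)E(Γ₋) ≤ min{S(ρ^A), S(ρ^B)}`.
(For the zero vector, `entN` evaluates to `0`, so a term with `n_± = 0` reads as `0`.) -/
theorem plus_minus_lower_bound {dA dB : ℕ}
    (Ψ Φ : TensorSpace dA dB) (hΨ : ‖Ψ‖ = 1) (hΦ : ‖Φ‖ = 1)
    (α β : ℂ) (hαβ : ‖α‖ ^ 2 + ‖β‖ ^ 2 = 1) :
    ‖α • Ψ + β • Φ‖ ^ 2 / 2 * entN (α • Ψ + β • Φ)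
      + ‖α • Ψ - β • Φ‖ ^ 2 / 2 * entN (α • Ψ - β • Φ)
    ≤ min (vnEntropy ((‖α‖ ^ 2 : ℝ) • trB (ketbra Ψ) + (‖β‖ ^ 2 : ℝ) • trB (ketbra Φ)))
          (vnEntropy ((‖α‖ ^ 2 : ℝ) • trA (ketbra Ψ) + (‖β‖ ^ 2 : ℝ) • trA (ketbra Φ))) := by
  have hsum : ‖α • Ψ + β • Φ‖ ^ 2 / 2 + ‖α • Ψ - β • Φ‖ ^ 2 / 2 = 1 := by
    have h := parallelogram_law_with_norm ℂ (α • Ψ) (β • Φ)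
    rw [norm_smul, norm_smul, hΨ, hΦ] at h
    nlinarith [h, hαβ]
  refine le_min ?_ ?_
  · rw [trB_avg]
    exact vnEntropy_concave (trB_psd _) (trB_psd _) (by positivity) (by positivity) hsum
  · rw [trA_avg, entN, entN, ent_eq_trA, ent_eq_trA]
    exact vnEntropy_concave (trA_psd _) (trA_psd _) (by positivity) (by positivity) hsum

end EoS
end
end

section
/- Let Ψ and Φ be unit vectors in H = ℂ^{d_A} ⊗ ℂ^{d_B} and let α, β ∈ ℂ with |α|² + |β|² = 1 be such that Γ = αΨ + βΦ ≠ 0. Then for every t with 0 < t < 1, ‖Γ‖² · E(Γ) ≤ f(t), where f(t) = [(t|β|² + (1−t)|α|²) / (t(1−t))] · [ tE(Ψ) + (1−t)E(Φ) + h₂(t) ]. -/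
open scoped BigOperators

noncomputable section

namespace EoS

variable {dA dB : ℕ}

section helpers

open Real

lemma jensen_sub {ι : Type*} [Fintype ι] (w ν : ι → ℝ) (hw : ∀ i, 0 ≤ w i)
    (hs : ∑ i, w i ≤ 1) (hν : ∀ i, 0 ≤ ν i) :
    ∑ i, w i * negMulLog (ν i) ≤ negMulLog (∑ i, w i * ν i) := by
  have h := Real.concaveOn_negMulLog.le_map_sum (t := (Finset.univ : Finset (Option ι)))
    (w := fun o => o.elim (1 - ∑ i, w i) w) (p := fun o => o.elim 0 ν)
    (by
      rintro (_ | i) _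
      · simpa using hs
      · exact hw i)
    (by simp [Fintype.sum_option])
    (by
      rintro (_ | i) _
      · simp
      · exact hν i)
  simpa [Fintype.sum_option] using h

variable {E : Type*} [NormedAddCommGroup E] [InnerProductSpace ℂ E]

lemma pinch {n : Type*} [Fintype n] (f e : OrthonormalBasis n ℂ E) (l : n → ℝ)
    (hl : ∀ i, 0 ≤ l i) :
    ∑ i, negMulLog (l i) ≤ ∑ j, negMulLog (∑ i, ‖inner ℂ (e j) (f i)‖ ^ 2 * l i) := by
  calc ∑ i, negMulLog (l i)
      = ∑ i, (∑ j, ‖inner ℂ (e j) (f i)‖ ^ 2) * negMulLog (l i) := by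
        refine Finset.sum_congr rfl fun i _ => ?_
        rw [e.sum_sq_norm_inner_right, f.norm_eq_one]; simp
    _ = ∑ j, ∑ i, ‖inner ℂ (e j) (f i)‖ ^ 2 * negMulLog (l i) := by
        simp_rw [Finset.sum_mul]; exact Finset.sum_comm
    _ ≤ _ := by
        refine Finset.sum_le_sum fun j _ => jensen_sub _ _ (fun i => by positivity) ?_ hl
        have : ∑ i, ‖inner ℂ (e j) (f i)‖ ^ 2 = ∑ i, ‖inner ℂ (f i) (e j)‖ ^ 2 :=
          Finset.sum_congr rfl fun i _ => by rw [norm_inner_symm]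
        rw [this, f.sum_sq_norm_inner_right, e.norm_eq_one]; simp

lemma mix {n K : Type*} [Fintype n] [DecidableEq n] [Fintype K] (e : OrthonormalBasis n ℂ E)
    (v : K → E) (ν : n → ℝ)
    (h : ∀ i j, ∑ k, inner ℂ (e i) (v k) * inner ℂ (v k) (e j) = if i = j then (ν j : ℂ) else 0) :
    ∑ j, negMulLog (ν j) ≤ ∑ k, negMulLog (‖v k‖ ^ 2) := by
  have hdiag : ∀ j, ∑ k, ‖inner ℂ (e j) (v k)‖ ^ 2 = ν j := by
    intro j
    have := h j j
    rw [if_pos rfl] at this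
    have h2 : ∀ k, inner ℂ (e j) (v k) * inner ℂ (v k) (e j)
        = ((‖inner ℂ (e j) (v k)‖ ^ 2 : ℝ) : ℂ) := by
      intro k
      rw [← inner_conj_symm (v k) (e j), Complex.mul_conj, Complex.normSq_eq_norm_sq]
    simp_rw [h2] at this
    exact_mod_cast this
  have hν : ∀ j, 0 ≤ ν j := fun j => by rw [← hdiag j]; positivity
  have hz : ∀ j k, ν j = 0 → ‖inner ℂ (e j) (v k)‖ ^ 2 = 0 := by
    intro j k h0
    have := hdiag j
    rw [h0, Finset.sum_eq_zero_iff_of_nonneg (fun _ _ => by positivity)] at this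
    exact this k (Finset.mem_univ _)
  -- Bessel
  have hb : ∀ k, ∑ j, ‖inner ℂ (e j) (v k)‖ ^ 2 / ν j ≤ 1 := by
    intro k
    set s := ∑ j, ‖inner ℂ (e j) (v k)‖ ^ 2 / ν j with hs
    set c : n → ℂ := fun j => inner ℂ (e j) (v k) / (ν j : ℂ) with hc
    set y : E := ∑ j, c j • e j with hy
    have h1 : inner ℂ (v k) y = (s : ℂ) := by
      rw [hy, inner_sum, hs]
      push_cast
      refine Finset.sum_congr rfl fun j _ => ?_
      rw [inner_smul_right, hc, ← inner_conj_symm (v k) (e j)]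
      simp only []
      rw [div_mul_eq_mul_div, Complex.mul_conj, Complex.normSq_eq_norm_sq]
      push_cast; rfl
    have h2 : ((∑ k', ‖inner ℂ (v k') y‖ ^ 2 : ℝ) : ℂ) = s := by
      have : ((∑ k', ‖inner ℂ (v k') y‖ ^ 2 : ℝ) : ℂ)
          = ∑ i, ∑ j, (starRingEnd ℂ) (c i) * c j *
            ∑ k', inner ℂ (e i) (v k') * inner ℂ (v k') (e j) := by
        push_cast
        have : ∀ k', ((‖inner ℂ (v k') y‖ : ℂ)) ^ 2 = ∑ i, ∑ j, (starRingEnd ℂ) (c i) * c j *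
            (inner ℂ (e i) (v k') * inner ℂ (v k') (e j)) := by
          intro k'
          rw [← Complex.conj_mul', inner_conj_symm, hy, sum_inner, inner_sum, Finset.sum_mul_sum]
          refine Finset.sum_congr rfl fun i _ => Finset.sum_congr rfl fun j _ => ?_
          rw [inner_smul_left, inner_smul_right]; ring
        simp_rw [this]
        rw [Finset.sum_comm]
        refine Finset.sum_congr rfl fun i _ => ?_
        rw [Finset.sum_comm]
        refine Finset.sum_congr rfl fun j _ => ?_
        rw [Finset.mul_sum]
      rw [this]
      simp_rw [h]
      simp only [mul_ite, mul_zero, Finset.sum_ite_eq, Finset.mem_univ, if_true]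
      rw [hs]; push_cast
      refine Finset.sum_congr rfl fun j _ => ?_
      rw [Complex.conj_mul', hc]
      simp only [norm_div, Complex.norm_real, Real.norm_eq_abs, abs_of_nonneg (hν j)]
      by_cases h0 : ν j = 0
      · simp [h0]
      · have : (ν j : ℂ) ≠ 0 := by exact_mod_cast h0
        push_cast
        field_simp
    have h3 : s ^ 2 ≤ s := by
      have h2' : ∑ k', ‖inner ℂ (v k') y‖ ^ 2 = s := by exact_mod_cast h2
      calc s ^ 2 = ‖inner ℂ (v k) y‖ ^ 2 := by rw [h1]; simp
        _ ≤ ∑ k', ‖inner ℂ (v k') y‖ ^ 2 :=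
          Finset.single_le_sum (f := fun k' => ‖inner ℂ (v k') y‖ ^ 2)
            (fun _ _ => by positivity) (Finset.mem_univ k)
        _ = s := h2'
    nlinarith
  calc ∑ j, negMulLog (ν j)
      = ∑ j, ∑ k, ‖inner ℂ (e j) (v k)‖ ^ 2 / ν j * negMulLog (ν j) := by
        refine Finset.sum_congr rfl fun j _ => ?_
        rw [← Finset.sum_mul, ← Finset.sum_div, hdiag]
        by_cases h0 : ν j = 0
        · simp [h0]
        · rw [div_self h0, one_mul]
    _ = ∑ k, ∑ j, ‖inner ℂ (e j) (v k)‖ ^ 2 / ν j * negMulLog (ν j) := Finset.sum_comm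
    _ ≤ ∑ k, negMulLog (∑ j, ‖inner ℂ (e j) (v k)‖ ^ 2 / ν j * ν j) :=
        Finset.sum_le_sum fun k _ =>
          jensen_sub _ _ (fun j => div_nonneg (by positivity) (hν j)) (hb k) hν
    _ = _ := by
        refine Finset.sum_congr rfl fun k _ => ?_
        congr 1
        rw [← e.sum_sq_norm_inner_right]
        refine Finset.sum_congr rfl fun j _ => ?_
        by_cases h0 : ν j = 0
        · rw [hz j k h0]; simp
        · field_simp

/-- sesquilinear form of a matrix -/
def sform {n : Type*} [Fintype n] (A : Matrix n n ℂ) (x y : EuclideanSpace ℂ n) : ℂ :=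
  inner ℂ x (WithLp.toLp 2 (A.mulVec y.ofLp))

lemma sform_add {n : Type*} [Fintype n] (A B : Matrix n n ℂ) (x y : EuclideanSpace ℂ n) :
    sform (A + B) x y = sform A x y + sform B x y := by
  simp [sform, Matrix.add_mulVec, inner_add_right]

lemma sform_smul {n : Type*} [Fintype n] (c : ℂ) (A : Matrix n n ℂ) (x y : EuclideanSpace ℂ n) :
    sform (c • A) x y = c * sform A x y := by
  simp [sform, Matrix.smul_mulVec, inner_smul_right]

lemma sform_eig {n : Type*} [Fintype n] [DecidableEq n] {A : Matrix n n ℂ} (hA : A.IsHermitian)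
    (x : EuclideanSpace ℂ n) (j : n) :
    sform A x (hA.eigenvectorBasis j) = hA.eigenvalues j * inner ℂ x (hA.eigenvectorBasis j) := by
  rw [sform, hA.mulVec_eigenvectorBasis]
  rw [show (WithLp.toLp 2 (hA.eigenvalues j • (hA.eigenvectorBasis j).ofLp) : EuclideanSpace ℂ n)
    = ((hA.eigenvalues j : ℝ) : ℂ) • hA.eigenvectorBasis j by ext; simp, inner_smul_right]

lemma sform_eig_eig {n : Type*} [Fintype n] [DecidableEq n] {A : Matrix n n ℂ}
    (hA : A.IsHermitian) (i j : n) :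
    sform A (hA.eigenvectorBasis i) (hA.eigenvectorBasis j)
      = if i = j then (hA.eigenvalues j : ℂ) else 0 := by
  rw [sform_eig, OrthonormalBasis.inner_eq_ite]; split_ifs <;> simp

lemma sform_spec {n : Type*} [Fintype n] [DecidableEq n] {A : Matrix n n ℂ} (hA : A.IsHermitian)
    (x y : EuclideanSpace ℂ n) :
    sform A x y = ∑ i, (hA.eigenvalues i : ℂ) *
      (inner ℂ x (hA.eigenvectorBasis i) * inner ℂ (hA.eigenvectorBasis i) y) := by
  conv_lhs => rw [← hA.eigenvectorBasis.sum_repr y]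
  have : ∀ (c : n → ℂ) (z : n → EuclideanSpace ℂ n),
      sform A x (∑ i, c i • z i) = ∑ i, c i * sform A x (z i) := by
    intro c z
    unfold sform
    rw [show (WithLp.toLp 2 (A.mulVec (∑ i, c i • z i).ofLp) : EuclideanSpace ℂ n)
      = ∑ i, c i • WithLp.toLp 2 (A.mulVec (z i).ofLp) by
        have := map_sum (Matrix.toEuclideanLin A) (fun i => c i • z i) Finset.univ
        simp only [map_smul] at this
        exact this]
    simp [inner_sum, inner_smul_right]
  rw [this]
  refine Finset.sum_congr rfl fun i _ => ?_
  rw [sform_eig, OrthonormalBasis.repr_apply_apply]; ring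

variable {dA dB : ℕ}

/-- column -/
def col (ψ : TensorSpace dA dB) (b : Fin dB) : EuclideanSpace ℂ (Fin dA) :=
  WithLp.toLp 2 fun a => ψ (a, b)

lemma sform_trB (ψ : TensorSpace dA dB) (x y : EuclideanSpace ℂ (Fin dA)) :
    sform (trB (ketbra ψ)) x y = ∑ b, inner ℂ x (col ψ b) * inner ℂ (col ψ b) y := by
  have hL : sform (trB (ketbra ψ)) x y
      = ∑ i, (∑ j, (∑ b, ψ (i, b) * (starRingEnd ℂ) (ψ (j, b))) * y j) * (starRingEnd ℂ) (x i) := by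
    simp [sform, trB, ketbra, PiLp.inner_apply, Matrix.mulVec, dotProduct]
  have hR : ∀ b, inner ℂ x (col ψ b) * inner ℂ (col ψ b) y
      = ∑ i, ∑ j, ψ (i, b) * (starRingEnd ℂ) (x i) * (y j * (starRingEnd ℂ) (ψ (j, b))) := by
    intro b
    rw [← Finset.sum_mul_sum]
    simp [col, PiLp.inner_apply]
  rw [hL]
  simp_rw [hR]
  rw [Finset.sum_comm]
  refine Finset.sum_congr rfl fun i _ => ?_
  rw [Finset.sum_comm, Finset.sum_mul]
  refine Finset.sum_congr rfl fun j _ => ?_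
  rw [Finset.sum_mul, Finset.sum_mul]
  refine Finset.sum_congr rfl fun b _ => ?_
  ring

lemma herm_trB (ψ : TensorSpace dA dB) : (trB (ketbra ψ)).IsHermitian := by
  ext i j
  simp [trB, ketbra, Matrix.conjTranspose_apply, mul_comm]

/-- quadratic form -/
def qf (ψ : TensorSpace dA dB) (x : EuclideanSpace ℂ (Fin dA)) : ℝ :=
  ∑ b, ‖inner ℂ x (col ψ b)‖ ^ 2

lemma sform_qf (ψ : TensorSpace dA dB) (x : EuclideanSpace ℂ (Fin dA)) :
    sform (trB (ketbra ψ)) x x = (qf ψ x : ℂ) := by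
  rw [sform_trB, qf]; push_cast
  refine Finset.sum_congr rfl fun b _ => ?_
  rw [← inner_conj_symm (col ψ b) x, Complex.mul_conj, Complex.normSq_eq_norm_sq]; push_cast; rfl

lemma qf_nonneg (ψ : TensorSpace dA dB) (x : EuclideanSpace ℂ (Fin dA)) : 0 ≤ qf ψ x := by
  unfold qf; positivity

lemma qf_sum (ψ : TensorSpace dA dB) (e : OrthonormalBasis (Fin dA) ℂ (EuclideanSpace ℂ (Fin dA))) :
    ∑ j, qf ψ (e j) = ‖ψ‖ ^ 2 := by
  unfold qf
  rw [Finset.sum_comm]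
  simp_rw [e.sum_sq_norm_inner_right]
  simp_rw [EuclideanSpace.norm_sq_eq]
  rw [Fintype.sum_prod_type, Finset.sum_comm]
  rfl

lemma qf_eig (ψ : TensorSpace dA dB) (j : Fin dA) :
    qf ψ ((herm_trB ψ).eigenvectorBasis j) = (herm_trB ψ).eigenvalues j := by
  have h := sform_eig_eig (herm_trB ψ) j j
  rw [if_pos rfl, sform_qf] at h
  exact_mod_cast h

lemma eig_nonneg (ψ : TensorSpace dA dB) (j : Fin dA) : 0 ≤ (herm_trB ψ).eigenvalues j := by
  rw [← qf_eig]; exact qf_nonneg _ _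

lemma eig_sum (ψ : TensorSpace dA dB) : ∑ j, (herm_trB ψ).eigenvalues j = ‖ψ‖ ^ 2 := by
  simp_rw [← qf_eig]; exact qf_sum _ _

lemma qf_spec (ψ : TensorSpace dA dB) (x : EuclideanSpace ℂ (Fin dA)) :
    qf ψ x = ∑ i, ‖inner ℂ x ((herm_trB ψ).eigenvectorBasis i)‖ ^ 2 *
      (herm_trB ψ).eigenvalues i := by
  have h := sform_spec (herm_trB ψ) x x
  rw [sform_qf] at h
  have h2 : ∀ i, inner ℂ x ((herm_trB ψ).eigenvectorBasis i) *
      inner ℂ ((herm_trB ψ).eigenvectorBasis i) x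
        = ((‖inner ℂ x ((herm_trB ψ).eigenvectorBasis i)‖ ^ 2 : ℝ) : ℂ) := by
    intro k
    rw [← inner_conj_symm _ x, Complex.mul_conj, Complex.normSq_eq_norm_sq]
  simp_rw [h2] at h
  simp_rw [mul_comm]
  exact_mod_cast h

lemma vn_eq {n : Type*} [Fintype n] [DecidableEq n] {A : Matrix n n ℂ} (hA : A.IsHermitian) :
    vnEntropy A = (∑ i, negMulLog (hA.eigenvalues i)) / Real.log 2 := by
  rw [vnEntropy, dif_pos hA, Finset.sum_div, ← Finset.sum_neg_distrib]
  refine Finset.sum_congr rfl fun i _ => ?_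
  rw [negMulLog, Real.logb]; ring

/-- natural-log entropy -/
def ne (ψ : TensorSpace dA dB) : ℝ := ∑ i, negMulLog ((herm_trB ψ).eigenvalues i)

lemma ent_eq (ψ : TensorSpace dA dB) : ent ψ = ne ψ / Real.log 2 := vn_eq _

lemma qf_comb (Ψ Φ : TensorSpace dA dB) (α β : ℂ) (t : ℝ) (h0 : 0 < t) (h1 : t < 1)
    (x : EuclideanSpace ℂ (Fin dA)) :
    qf (α • Ψ + β • Φ) x ≤ (t * ‖β‖ ^ 2 + (1 - t) * ‖α‖ ^ 2) / (t * (1 - t)) *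
      (t * qf Ψ x + (1 - t) * qf Φ x) := by
  unfold qf
  rw [Finset.mul_sum, Finset.mul_sum, ← Finset.sum_add_distrib, Finset.mul_sum]
  refine Finset.sum_le_sum fun b _ => ?_
  have : col (α • Ψ + β • Φ) b = α • col Ψ b + β • col Φ b := by ext; simp [col]
  rw [this, inner_add_right, inner_smul_right, inner_smul_right]
  set p := inner ℂ x (col Ψ b)
  set q := inner ℂ x (col Φ b)
  have h1' : 0 < 1 - t := by linarith
  have htri : ‖α * p + β * q‖ ≤ ‖α‖ * ‖p‖ + ‖β‖ * ‖q‖ := by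
    simpa using norm_add_le (α * p) (β * q)
  refine (pow_le_pow_left₀ (norm_nonneg _) htri 2).trans ?_
  rw [div_mul_eq_mul_div, le_div_iff₀ (by positivity)]
  nlinarith [sq_nonneg (t * ‖β‖ * ‖p‖ - (1 - t) * ‖α‖ * ‖q‖)]

lemma qf_smul (ψ : TensorSpace dA dB) (c : ℝ) (x : EuclideanSpace ℂ (Fin dA)) :
    qf (c • ψ) x = c ^ 2 * qf ψ x := by
  unfold qf
  rw [Finset.mul_sum]
  refine Finset.sum_congr rfl fun b _ => ?_
  have : col (c • ψ) b = (c : ℂ) • col ψ b := by ext; simp [col]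
  rw [this, inner_smul_right, norm_mul, mul_pow]; simp

end helpers

/-- Theorem 3 of the paper: the family of upper bounds
`‖Γ‖² E(Γ) ≤ f(t)` for all `0 < t < 1`. -/
theorem upper_bound_family {dA dB : ℕ}
    (Ψ Φ : TensorSpace dA dB) (hΨ : ‖Ψ‖ = 1) (hΦ : ‖Φ‖ = 1)
    (α β : ℂ) (hαβ : ‖α‖ ^ 2 + ‖β‖ ^ 2 = 1) (hΓ : α • Ψ + β • Φ ≠ 0) :
    ∀ t : ℝ, 0 < t → t < 1 →
      ‖α • Ψ + β • Φ‖ ^ 2 * entN (α • Ψ + β • Φ)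
        ≤ (t * ‖β‖ ^ 2 + (1 - t) * ‖α‖ ^ 2) / (t * (1 - t))
          * (t * ent Ψ + (1 - t) * ent Φ + h2 t) := by
  intro t h0 h1
  have h1' : 0 < 1 - t := by linarith
  have hl2 : 0 < Real.log 2 := Real.log_pos (by norm_num)
  set Γ := α • Ψ + β • Φ with hΓd
  set C := (t * ‖β‖ ^ 2 + (1 - t) * ‖α‖ ^ 2) / (t * (1 - t)) with hC
  set G : TensorSpace dA dB := (‖Γ‖ : ℝ)⁻¹ • Γ with hG
  have hnΓ : 0 < ‖Γ‖ := norm_pos_iff.2 hΓ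
  have hCpos : 0 < C := by
    refine div_pos ?_ (by positivity)
    by_cases ha : ‖α‖ = 0
    · have : ‖β‖ ^ 2 = 1 := by rw [ha] at hαβ; linarith
      rw [ha, this]; linarith
    · positivity
  have hGn : ‖G‖ = 1 := by
    rw [hG, norm_smul]; simp [hnΓ.ne']
  set σ : Matrix (Fin dA) (Fin dA) ℂ :=
    (t : ℂ) • trB (ketbra Ψ) + ((1 - t : ℝ) : ℂ) • trB (ketbra Φ) with hσd
  have hσ : σ.IsHermitian := by
    refine Matrix.IsHermitian.add ?_ ?_
    · have := (herm_trB Ψ)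
      rw [Matrix.IsHermitian] at this ⊢
      rw [Matrix.conjTranspose_smul, this]; simp
    · have := (herm_trB Φ)
      rw [Matrix.IsHermitian] at this ⊢
      rw [Matrix.conjTranspose_smul, this]; simp
  set ν := hσ.eigenvalues with hν
  set e := hσ.eigenvectorBasis with he
  have hsf : ∀ x y, sform σ x y = (t : ℂ) * sform (trB (ketbra Ψ)) x y
      + ((1 - t : ℝ) : ℂ) * sform (trB (ketbra Φ)) x y := by
    intro x y
    rw [hσd, sform_add, sform_smul, sform_smul]
  have hνq : ∀ j, ν j = t * qf Ψ (e j) + (1 - t) * qf Φ (e j) := by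
    intro j
    have h := sform_eig_eig hσ j j
    rw [if_pos rfl, hsf, sform_qf, sform_qf] at h
    exact_mod_cast h.symm
  have hνsum : ∑ j, ν j = 1 := by
    simp_rw [hνq]
    rw [Finset.sum_add_distrib, ← Finset.mul_sum, ← Finset.mul_sum, qf_sum, qf_sum, hΨ, hΦ]
    ring
  -- upper bound on the entropy of the mixture
  have hup : ∑ j, Real.negMulLog (ν j) ≤ t * ne Ψ + (1 - t) * ne Φ
      + (Real.negMulLog t + Real.negMulLog (1 - t)) := by
    have hm := mix e (K := Fin dA ⊕ Fin dA)
      (Sum.elim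
        (fun i => ((Real.sqrt (t * (herm_trB Ψ).eigenvalues i) : ℝ) : ℂ) •
          (herm_trB Ψ).eigenvectorBasis i)
        (fun i => ((Real.sqrt ((1 - t) * (herm_trB Φ).eigenvalues i) : ℝ) : ℂ) •
          (herm_trB Φ).eigenvectorBasis i)) ν
      (by
        intro i j
        rw [← sform_eig_eig hσ i j, hsf, sform_spec (herm_trB Ψ), sform_spec (herm_trB Φ),
          Fintype.sum_sum_type, Finset.mul_sum, Finset.mul_sum]
        have key : ∀ (s l : ℝ) (x y z : EuclideanSpace ℂ (Fin dA)), 0 ≤ s → 0 ≤ l →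
            inner ℂ x (((Real.sqrt (s * l) : ℝ) : ℂ) • z)
              * inner ℂ (((Real.sqrt (s * l) : ℝ) : ℂ) • z) y
            = (s : ℂ) * ((l : ℂ) * (inner ℂ x z * inner ℂ z y)) := by
          intro s l x y z hs hl
          rw [inner_smul_right, inner_smul_left, Complex.conj_ofReal]
          have : ((Real.sqrt (s * l) : ℝ) : ℂ) * ((Real.sqrt (s * l) : ℝ) : ℂ)
              = (s : ℂ) * (l : ℂ) := by
            rw [← Complex.ofReal_mul, Real.mul_self_sqrt (by positivity), Complex.ofReal_mul]
          linear_combination (inner ℂ x z * inner ℂ z y) * this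
        congr 1
        · refine Finset.sum_congr rfl fun k _ => ?_
          exact key _ _ _ _ _ h0.le (eig_nonneg _ _)
        · refine Finset.sum_congr rfl fun k _ => ?_
          exact key _ _ _ _ _ h1'.le (eig_nonneg _ _))
    refine hm.trans (le_of_eq ?_)
    have key2 : ∀ (s : ℝ) (χ : TensorSpace dA dB), 0 ≤ s → ‖χ‖ = 1 →
        ∑ i, Real.negMulLog (‖((Real.sqrt (s * (herm_trB χ).eigenvalues i) : ℝ) : ℂ) •
          (herm_trB χ).eigenvectorBasis i‖ ^ 2) = s * ne χ + Real.negMulLog s := by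
      intro s χ hs hχ
      have : ∀ i, Real.negMulLog (‖((Real.sqrt (s * (herm_trB χ).eigenvalues i) : ℝ) : ℂ) •
          (herm_trB χ).eigenvectorBasis i‖ ^ 2) = (herm_trB χ).eigenvalues i * Real.negMulLog s
            + s * Real.negMulLog ((herm_trB χ).eigenvalues i) := by
        intro i
        rw [← Real.negMulLog_mul, norm_smul, OrthonormalBasis.norm_eq_one, mul_one,
          Complex.norm_real, Real.norm_eq_abs, sq_abs,
          Real.sq_sqrt (mul_nonneg hs (eig_nonneg _ _))]
      simp_rw [this]
      rw [Finset.sum_add_distrib, ← Finset.sum_mul, ← Finset.mul_sum, eig_sum, hχ, ne]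
      ring
    rw [Fintype.sum_sum_type]
    simp only [Sum.elim_inl, Sum.elim_inr]
    rw [key2 t Ψ h0.le hΨ, key2 (1 - t) Φ h1'.le hΦ]
    ring
  -- lower bound
  set q := ‖Γ‖ ^ 2 / C with hq
  have hq0 : 0 ≤ q := by positivity
  have hqa : ∀ j, q * qf G (e j) ≤ ν j := by
    intro j
    rw [hG, qf_smul, hνq, hq]
    have := qf_comb Ψ Φ α β t h0 h1 (e j)
    rw [← hC, ← hΓd] at this
    have h3 : ‖Γ‖ ^ 2 / C * ((‖Γ‖)⁻¹ ^ 2 * qf Γ (e j)) = qf Γ (e j) / C := by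
      field_simp
    rw [h3, div_le_iff₀ hCpos]; linarith
  have hsumG : ∑ j, qf G (e j) = 1 := by rw [qf_sum, hGn]; norm_num
  have hrem : ∑ j, (ν j - q * qf G (e j)) = 1 - q := by
    rw [Finset.sum_sub_distrib, hνsum, ← Finset.mul_sum, hsumG, mul_one]
  have hr1 : ∀ j, ν j - q * qf G (e j) ≤ 1 - q := by
    intro j
    rw [← hrem]
    exact Finset.single_le_sum (f := fun j => ν j - q * qf G (e j))
      (fun i _ => sub_nonneg.2 (hqa i)) (Finset.mem_univ j)
  have hq1 : 0 ≤ 1 - q := by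
    rw [← hrem]; exact Finset.sum_nonneg fun i _ => sub_nonneg.2 (hqa i)
  have hlow : q * ne G ≤ ∑ j, Real.negMulLog (ν j) := by
    have hp : ne G ≤ ∑ j, Real.negMulLog (qf G (e j)) := by
      have := pinch (herm_trB G).eigenvectorBasis e (herm_trB G).eigenvalues (eig_nonneg G)
      simp_rw [← qf_spec] at this
      exact this
    refine (mul_le_mul_of_nonneg_left hp hq0).trans ?_
    rw [Finset.mul_sum]
    refine Finset.sum_le_sum fun j _ => ?_
    rcases hq1.eq_or_lt with hz | hz
    · have ha := hr1 j
      have hb := hqa j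
      have : ν j = qf G (e j) := by
        have hqq : q = 1 := by linarith
        rw [hqq] at ha hb; linarith
      have hqq : q = 1 := by linarith
      rw [this, hqq, one_mul]
    · set r := (ν j - q * qf G (e j)) / (1 - q) with hr
      have hr0 : 0 ≤ r := div_nonneg (sub_nonneg.2 (hqa j)) hq1
      have hr1 : r ≤ 1 := by rw [hr, div_le_one hz]; exact hr1 j
      have hc := Real.concaveOn_negMulLog.2 (x := qf G (e j)) (y := r)
        (qf_nonneg _ _) hr0 hq0 hq1 (by ring)
      have h4 : q • qf G (e j) + (1 - q) • r = ν j := by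
        rw [hr, smul_eq_mul, smul_eq_mul, mul_div_cancel₀ _ hz.ne']; ring
      rw [h4, smul_eq_mul, smul_eq_mul] at hc
      have := mul_nonneg hq1 (Real.negMulLog_nonneg hr0 hr1)
      linarith
  have hfin := hlow.trans hup
  rw [entN, ← hG, ent_eq, ent_eq, ent_eq]
  have hh : h2 t = (Real.negMulLog t + Real.negMulLog (1 - t)) / Real.log 2 := by
    rw [h2, Real.negMulLog, Real.negMulLog, Real.logb, Real.logb]; ring
  rw [hh]
  have h5 : ‖Γ‖ ^ 2 = C * q := by rw [hq]; field_simp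
  have h6 : C * (t * (ne Ψ / Real.log 2) + (1 - t) * (ne Φ / Real.log 2)
      + (Real.negMulLog t + Real.negMulLog (1 - t)) / Real.log 2)
      = C * (t * ne Ψ + (1 - t) * ne Φ + (Real.negMulLog t + Real.negMulLog (1 - t)))
        / Real.log 2 := by ring
  rw [h6, h5, mul_assoc, ← mul_div_assoc, ← mul_div_assoc]
  exact div_le_div_of_nonneg_right (mul_le_mul_of_nonneg_left hfin hCpos.le) hl2.le

end EoS
end
end
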